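/- Let λ, χ, ψ ∈ ℝ with χ ≥ 0, ψ ≥ 0, and (χ > 0 or λ > 0), and define the generalized inverse Gaussian Poisson (GIG-P) sequence f : ℕ → ℝ by f(n) = ∫₀^∞ e^{−x} xⁿ / n! · x^{λ−1} exp(−(χ/x + ψx)/2) dx (these integrals are finite). Then f is a log-concave sequence, i.e., f(n+1)² ≥ f(n)·f(n+2) for all n ∈ ℕ, if and only if λ ≥ 1. -/

import Mathlib

open MeasureTheory Set Real

noncomputable def gigH (a b s x : ℝ) : ℝ := x ^ s * Real.exp (-(a * x + b / x))

noncomputable def gigK (a b s : ℝ) : ℝ := ∫ x in Ioi (0:ℝ), gigH a b (s - 1) x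

lemma gig_bound (b s : ℝ) (hb : 0 ≤ b) (h : 0 < b ∨ 0 < s) :
    ∃ (N : ℕ) (C : ℝ), 0 < s + N ∧ 0 ≤ C ∧ ∀ x : ℝ, 0 < x → Real.exp (-(b / x)) ≤ C * x ^ N := by
  rcases h with h | h
  · obtain ⟨N, hN⟩ := exists_nat_gt (-s)
    refine ⟨N, N.factorial / b ^ N, by linarith, by positivity, fun x hx => ?_⟩
    have h1 := Real.pow_div_factorial_le_exp (b / x) (by positivity) N
    rw [Real.exp_neg]
    have h2 : (N.factorial : ℝ) / b ^ N * x ^ N = ((b / x) ^ N / N.factorial)⁻¹ := by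
      rw [div_pow]; field_simp
    rw [h2]
    exact inv_anti₀ (by positivity) h1
  · refine ⟨0, 1, by simpa using h, by norm_num, fun x hx => ?_⟩
    simp only [pow_zero, mul_one]
    rw [Real.exp_le_one_iff]
    have : 0 ≤ b / x := by positivity
    linarith

lemma gigH_nonneg (a b s x : ℝ) (hx : 0 < x) : 0 ≤ gigH a b s x := by
  unfold gigH; positivity

lemma gigH_bound (a b s : ℝ) (hb : 0 ≤ b) (h : 0 < b ∨ 0 < s) :
    ∃ (t C : ℝ), 0 < t ∧ 0 ≤ C ∧ ∀ r x : ℝ, 0 < x →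
      gigH a b (s + r) x ≤ C * (x ^ (t + r) * Real.exp (-a * x)) := by
  obtain ⟨N, C, h1, h2, h3⟩ := gig_bound b s hb h
  refine ⟨s + N, C, h1, h2, fun r x hx => ?_⟩
  unfold gigH
  have e1 : Real.exp (-(a * x + b / x)) = Real.exp (-a * x) * Real.exp (-(b / x)) := by
    rw [← Real.exp_add]; ring_nf
  have e2 : x ^ (s + N + r) = x ^ (s + r) * x ^ N := by
    rw [← Real.rpow_natCast x N, ← Real.rpow_add hx]; ring_nf
  rw [e1, e2]
  have := mul_le_mul_of_nonneg_left (h3 x hx)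
    (show 0 ≤ x ^ (s + r) * Real.exp (-a * x) by positivity)
  linarith

lemma gigH_cont (a b s : ℝ) : ContinuousOn (gigH a b s) (Ioi 0) := by
  unfold gigH
  intro x hx
  have hx : (0:ℝ) < x := hx
  apply ContinuousAt.continuousWithinAt
  have : x ≠ 0 := hx.ne'
  exact (Real.continuousAt_rpow_const x s (Or.inl this)).mul (by fun_prop (disch := assumption))

lemma gigH_int (a b s : ℝ) (ha : 0 < a) (hb : 0 ≤ b) (h : 0 < b ∨ 0 < s) :
    IntegrableOn (gigH a b (s - 1)) (Ioi 0) := by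
  obtain ⟨t, C, h1, h2, h3⟩ := gigH_bound a b s hb h
  have hi := (integrableOn_rpow_mul_exp_neg_mul_rpow (p := 1) (s := t - 1) (b := a)
    (by linarith) (by norm_num) ha).const_mul C
  refine Integrable.mono' hi ((gigH_cont a b (s-1)).aestronglyMeasurable measurableSet_Ioi) ?_
  filter_upwards [ae_restrict_mem measurableSet_Ioi] with x hx
  rw [Real.norm_of_nonneg (gigH_nonneg _ _ _ _ hx)]
  have := h3 (-1) x hx
  simpa [sub_eq_add_neg] using this

lemma gigK_pos (a b s : ℝ) (ha : 0 < a) (hb : 0 ≤ b) (h : 0 < b ∨ 0 < s) : 0 < gigK a b s := by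
  unfold gigK
  rw [setIntegral_pos_iff_support_of_nonneg_ae]
  · have : Function.support (gigH a b (s-1)) ∩ Ioi 0 = Ioi 0 := by
      apply inter_eq_right.mpr
      intro x hx
      have hx : (0:ℝ) < x := hx
      have : 0 < gigH a b (s-1) x := by unfold gigH; positivity
      exact this.ne'
    rw [this]; simp
  · filter_upwards [ae_restrict_mem measurableSet_Ioi] with x hx
    exact gigH_nonneg _ _ _ _ hx
  · exact gigH_int a b s ha hb h

lemma gigH_shift (a b s x : ℝ) (hx : 0 < x) : gigH a b (s + 1) x = x * gigH a b s x := by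
  unfold gigH; rw [Real.rpow_add hx, Real.rpow_one]; ring

lemma gigK_cs (a b s : ℝ) (ha : 0 < a) (hb : 0 ≤ b) (h : 0 < b ∨ 0 < s) :
    gigK a b (s + 1) ^ 2 ≤ gigK a b s * gigK a b (s + 2) := by
  have p0 := gigK_pos a b s ha hb h
  have i0 := gigH_int a b s ha hb h
  have i1 := gigH_int a b (s+1) ha hb (h.imp id (by intro h; linarith))
  have i2 := gigH_int a b (s+2) ha hb (h.imp id (by intro h; linarith))
  set c := gigK a b (s+1) / gigK a b s with hc
  have key : 0 ≤ ∫ x in Ioi (0:ℝ), (gigH a b (s+2-1) x - 2 * c * gigH a b (s+1-1) x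
      + c^2 * gigH a b (s-1) x) := by
    apply setIntegral_nonneg measurableSet_Ioi
    intro x hx
    have e1 : gigH a b (s+1-1) x = x * gigH a b (s-1) x := by
      rw [← gigH_shift a b _ x hx]; ring_nf
    have e2 : gigH a b (s+2-1) x = x * (x * gigH a b (s-1) x) := by
      rw [← gigH_shift a b _ x hx, ← gigH_shift a b _ x hx]; ring_nf
    rw [e1, e2]
    have := mul_nonneg (sq_nonneg (x - c)) (gigH_nonneg a b (s-1) x hx)
    linarith
  have j : IntegrableOn (fun x => gigH a b (s+2-1) x - 2 * c * gigH a b (s+1-1) x) (Ioi 0) :=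
    i2.sub (i1.const_mul _)
  rw [integral_add j (i0.const_mul _),
    integral_sub i2 (i1.const_mul _), integral_const_mul, integral_const_mul] at key
  change 0 ≤ gigK a b (s+2) - 2 * c * gigK a b (s+1) + c^2 * gigK a b s at key
  have e : gigK a b (s+1) = c * gigK a b s := by rw [hc]; field_simp
  rw [e] at key ⊢
  have := mul_nonneg p0.le key
  linarith

lemma gigK_rec (a b s : ℝ) (ha : 0 < a) (hb : 0 ≤ b) (h : 0 < b ∨ 0 < s) :
    a * gigK a b (s + 1) = s * gigK a b s + b * gigK a b (s - 1) := by
  have i0 := gigH_int a b s ha hb h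
  have i1 := gigH_int a b (s+1) ha hb (h.imp id (by intro h; linarith))
  have i2 : IntegrableOn (fun x => b * gigH a b (s - 1 - 1) x) (Ioi 0) := by
    rcases hb.eq_or_lt with hb' | hb'
    · subst hb'; simp
    · exact (gigH_int a b (s-1) ha hb (Or.inl hb')).const_mul b
  obtain ⟨t, C, h1, h2, h3⟩ := gigH_bound a b s hb h
  simp only [gigK]
  have hI : IntegrableOn (fun x => s * gigH a b (s-1) x - a * gigH a b (s+1-1) x
      + b * gigH a b (s-1-1) x) (Ioi 0) := ((i0.const_mul s).sub (i1.const_mul a)).add i2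
  have hd : ∀ x ∈ Ioi (0:ℝ), HasDerivAt (gigH a b s) (s * gigH a b (s-1) x
      - a * gigH a b (s+1-1) x + b * gigH a b (s-1-1) x) x := by
    intro x hx
    have hx : (0:ℝ) < x := hx
    have d1 := Real.hasDerivAt_rpow_const (x := x) (p := s) (Or.inl hx.ne')
    have d2 : HasDerivAt (fun x : ℝ => -(a * x + b / x)) (-(a * 1 + b * (-(x^2)⁻¹))) x := by
      simp only [div_eq_mul_inv]
      exact (((hasDerivAt_id x).const_mul a).add ((hasDerivAt_inv hx.ne').const_mul b)).neg
    have d := d1.mul d2.exp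
    refine d.congr_deriv ?_
    unfold gigH
    have e1 : x ^ (s - 1 - 1) = x ^ s * (x^2)⁻¹ := by
      rw [show s - 1 - 1 = s - (2:ℕ) by push_cast; ring, Real.rpow_sub_natCast hx.ne']
      rfl
    rw [e1, show s + 1 - 1 = s by ring]
    ring
  have hsq : ∀ l : Filter ℝ, (∀ᶠ x in l, 0 < x) →
      Filter.Tendsto (fun x : ℝ => C * (x ^ t * Real.exp (-a * x))) l (nhds 0) →
      Filter.Tendsto (gigH a b s) l (nhds 0) := by
    intro l hl hT
    refine squeeze_zero' ?_ ?_ hT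
    · filter_upwards [hl] with x hx using gigH_nonneg _ _ _ _ hx
    · filter_upwards [hl] with x hx
      simpa using h3 0 x hx
  have l0 : Filter.Tendsto (gigH a b s) (nhdsWithin 0 (Ioi 0)) (nhds 0) := by
    apply hsq _ self_mem_nhdsWithin
    have c : ContinuousAt (fun x : ℝ => C * (x ^ t * Real.exp (-a * x))) 0 := by
      have := Real.continuousAt_rpow_const 0 t (Or.inr h1.le)
      exact continuousAt_const.mul (this.mul (by fun_prop))
    have := c.tendsto
    simp only [Real.zero_rpow h1.ne', zero_mul, mul_zero] at this
    exact this.mono_left nhdsWithin_le_nhds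
  have l1 : Filter.Tendsto (gigH a b s) Filter.atTop (nhds 0) := by
    apply hsq _ (Filter.eventually_gt_atTop 0)
    simpa using (tendsto_rpow_mul_exp_neg_mul_atTop_nhds_zero t a ha).const_mul C
  have hu : ∀ x : ℝ, 0 < x → Function.update (gigH a b s) 0 0 =ᶠ[nhds x] gigH a b s := by
    intro x hx
    filter_upwards [lt_mem_nhds hx] with y hy
    exact Function.update_of_ne hy.ne' _ _
  have := integral_Ioi_of_hasDerivAt_of_tendsto (f := Function.update (gigH a b s) 0 0)
    (by rw [continuousWithinAt_update_same, Ici_sdiff_left]; exact l0)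
    (fun x hx => (hd x hx).congr_of_eventuallyEq (hu x hx)) hI
    (l1.congr' (by
      filter_upwards [Filter.eventually_gt_atTop (0:ℝ)] with y hy
      exact (Function.update_of_ne hy.ne' _ _).symm))
  rw [Function.update_self, sub_zero] at this
  have j : IntegrableOn (fun x => s * gigH a b (s-1) x - a * gigH a b (s+1-1) x) (Ioi 0) :=
    (i0.const_mul s).sub (i1.const_mul a)
  rw [integral_add j i2,
    integral_sub (i0.const_mul s) (i1.const_mul a), integral_const_mul, integral_const_mul,
    integral_const_mul] at this
  linarith

/-- Corollary 3(iii): the generalized inverse Gaussian Poisson (GIG-P) mass function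
is a log-concave sequence iff `λ ≥ 1`. -/
theorem gigp_logConcave_iff
    (lam χ ψ : ℝ) (hχ : 0 ≤ χ) (hψ : 0 ≤ ψ) (hpos : 0 < χ ∨ 0 < lam)
    (f : ℕ → ℝ)
    (hf : ∀ n, f n = ∫ x in Ioi (0:ℝ),
      Real.exp (-x) * x ^ n / (Nat.factorial n : ℝ) *
        (x ^ (lam - 1) * Real.exp (-(χ / x + ψ * x) / 2))) :
    (∀ n : ℕ, f n * f (n + 2) ≤ f (n + 1) ^ 2) ↔ 1 ≤ lam := by
  obtain ⟨a, ha'⟩ : ∃ a, a = 1 + ψ / 2 := ⟨_, rfl⟩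
  obtain ⟨b, hb'⟩ : ∃ b, b = χ / 2 := ⟨_, rfl⟩
  have ha : 0 < a := by rw [ha']; positivity
  have hb : 0 ≤ b := by rw [hb']; positivity
  have hp : 0 < b ∨ 0 < lam := hpos.imp (by intro h; rw [hb']; positivity) id
  have hpn : ∀ n : ℕ, 0 < b ∨ 0 < lam + n := fun n => hp.imp id (by intro h; positivity)
  have hfK : ∀ n, f n = gigK a b (lam + n) / n.factorial := by
    intro n
    rw [hf, gigK, ← integral_div]
    apply setIntegral_congr_fun measurableSet_Ioi
    intro x hx
    have hx : (0:ℝ) < x := hx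
    simp only [gigH]
    have e1 : x ^ (lam + n - 1) = x ^ (lam - 1) * x ^ n := by
      rw [← Real.rpow_natCast x n, ← Real.rpow_add hx]; ring_nf
    have e2 : Real.exp (-(a * x + b / x)) = Real.exp (-x) * Real.exp (-(χ / x + ψ * x) / 2) := by
      rw [← Real.exp_add, ha', hb']; ring_nf
    rw [e1, e2]; ring
  have main : ∀ n : ℕ, f n * f (n + 2) ≤ f (n + 1) ^ 2 ↔
      0 ≤ (lam - 1) * (gigK a b (lam + n) * gigK a b (lam + n + 1)) +
        b * ((n + 2) * (gigK a b (lam + n - 1) * gigK a b (lam + n + 1))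
          - (n + 1) * gigK a b (lam + n) ^ 2) := by
    intro n
    have r1 := gigK_rec a b (lam + n) ha hb (hpn n)
    have r2 := gigK_rec a b (lam + n + 1) ha hb
      (by have := hpn (n+1); push_cast at this; simpa [add_assoc] using this)
    rw [show lam + n + 1 - 1 = lam + n by ring] at r2
    rw [hfK, hfK, hfK, Nat.factorial_succ (n+1), Nat.factorial_succ n]
    push_cast
    rw [show lam + ((n:ℝ) + 2) = lam + n + 1 + 1 by ring,
      show lam + ((n:ℝ) + 1) = lam + n + 1 by ring]
    set A := gigK a b (lam + n - 1)
    set B := gigK a b (lam + n)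
    set C := gigK a b (lam + n + 1)
    set D := gigK a b (lam + n + 1 + 1)
    have hF : (0:ℝ) < n.factorial := by positivity
    set F : ℝ := (n.factorial : ℝ)
    have e : (lam - 1) * (B * C) + b * ((n + 2) * (A * C) - (n + 1) * B ^ 2)
        = (C ^ 2 * (n + 2) - (n + 1) * (B * D)) * a := by
      linear_combination (-(n + 2) * C) * r1 + (n + 1) * B * r2
    have e2 : (C / ((n + 1) * F)) ^ 2 - B / F * (D / ((n + 1 + 1) * ((n + 1) * F)))
        = (C ^ 2 * (n + 2) - (n + 1) * (B * D)) / ((n + 1) ^ 2 * (n + 2) * F ^ 2) := by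
      have : (n:ℝ) + 1 ≠ 0 := by positivity
      have : (n:ℝ) + 2 ≠ 0 := by positivity
      rw [show (n:ℝ) + 1 + 1 = n + 2 by ring]
      field_simp
    rw [e, ← sub_nonneg, e2]
    rw [le_div_iff₀ (by positivity), zero_mul, mul_nonneg_iff_of_pos_right ha]
  simp only [main]
  constructor
  · intro H
    by_contra! hl
    obtain ⟨n, hn⟩ := exists_nat_gt (max (2 - lam + b * a * (3 - lam + b * a) / (1 - lam)) (2 - lam))
    have hn1 := lt_of_le_of_lt (le_max_left _ _) hn
    have hn2 := lt_of_le_of_lt (le_max_right _ _) hn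
    have H := H n
    have q : ∀ s : ℝ, 0 < s → 0 < gigK a b s := fun s hs => gigK_pos a b s ha hb (Or.inr hs)
    have hA := q (lam + n - 1) (by linarith)
    have hB := q (lam + n) (by linarith)
    have hC := q (lam + n + 1) (by linarith)
    have r0 := gigK_rec a b (lam + n - 1) ha hb (Or.inr (by linarith))
    rw [show lam + n - 1 + 1 = lam + n by ring] at r0
    have r1 := gigK_rec a b (lam + n) ha hb (hpn n)
    have hZ : 0 ≤ b * gigK a b (lam + n - 1 - 1) := by
      apply mul_nonneg hb
      exact setIntegral_nonneg measurableSet_Ioi (fun x hx => gigH_nonneg _ _ _ _ hx)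
    set A := gigK a b (lam + n - 1)
    set B := gigK a b (lam + n)
    set C := gigK a b (lam + n + 1)
    obtain ⟨v, hv⟩ : ∃ v, v = lam + n - 1 := ⟨_, rfl⟩
    have hv1 : 1 < v := by linarith
    have hp : 0 < A / B := by positivity
    have hq : 0 < B / C := by positivity
    have eA : A = (A / B) * (B / C) * C := by field_simp
    have eB : B = (B / C) * C := by field_simp
    set p := A / B
    set q := B / C
    rw [← hv] at r0 hZ
    have hvp : v * p ≤ a := by
      have : v * p * B ≤ a * B := by
        have : p * B = A := by simp only [p]; field_simp
        nlinarith
      exact le_of_mul_le_mul_right this hB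
    have hr : a = (v + 1) * q + b * (p * q) := by
      have : a * C = ((v + 1) * q + b * (p * q)) * C := by
        rw [r1, eA, hv]; nth_rw 1 [eB]; ring
      exact mul_right_cancel₀ hC.ne' this
    have hH : 1 - lam ≤ b * ((n + 2) * p - (n + 1) * q) := by
      rw [eA, eB] at H
      have : 0 ≤ (q * C ^ 2) * (b * ((n + 2) * p - (n + 1) * q) - (1 - lam)) := by
        linarith
      have := nonneg_of_mul_nonneg_right this (by positivity)
      linarith
    have hbpq : 0 ≤ b * (p * q) := by positivity
    have hvq : v * q ≤ a := by nlinarith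
    have hpa : p ≤ a := by nlinarith
    have hnv : (n:ℝ) = v + 1 - lam := by linarith
    have s1 : (n + 2) * p - (n + 1) * q ≤ (3 - lam) * p + b * a * q := by
      rw [hnv]
      have t1 : b * (p * q) ≤ b * (a * q) := by gcongr
      have t2 : 0 ≤ (1 - lam) * q := mul_nonneg (by linarith) hq.le
      nlinarith
    have s2 : v * ((n + 2) * p - (n + 1) * q) ≤ (3 - lam) * a + b * a * a := by
      have u1 := mul_le_mul_of_nonneg_left s1 (show 0 ≤ v by linarith)
      have u2 := mul_le_mul_of_nonneg_left hvp (show 0 ≤ 3 - lam by linarith)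
      have u3 := mul_le_mul_of_nonneg_left hvq (show 0 ≤ b * a by positivity)
      linarith
    have s3 : v * (1 - lam) ≤ b * ((3 - lam) * a + b * a * a) := by
      have u1 := mul_le_mul_of_nonneg_left hH (show 0 ≤ v by linarith)
      have u2 := mul_le_mul_of_nonneg_left s2 hb
      linarith
    have s4 : b * a * (3 - lam + b * a) / (1 - lam) < v := by linarith
    rw [div_lt_iff₀ (by linarith)] at s4
    linarith
  · intro hl n
    have hB := gigK_pos a b (lam + n) ha hb (hpn n)
    have hC := gigK_pos a b (lam + n + 1) ha hb (Or.inr (by positivity))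
    apply add_nonneg
    · exact mul_nonneg (by linarith) (by positivity)
    · rcases hb.eq_or_lt with h0 | h0
      · rw [← h0]; simp
      · have cs := gigK_cs a b (lam + n - 1) ha hb (Or.inl h0)
        rw [show lam + n - 1 + 1 = lam + n by ring,
          show lam + n - 1 + 2 = lam + n + 1 by ring] at cs
        apply mul_nonneg hb
        have u := mul_le_mul_of_nonneg_left cs (show (0:ℝ) ≤ n + 2 by positivity)
        have := sq_nonneg (gigK a b (lam + n))
        linarith
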